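/- Let (𝒫, ℒ) be a 3-dimensional generalized projective space. Then every plane ℰ ⊆ 𝒫 and every line y ∈ ℒ have a common point. -/

import Mathlib

/-- A linear space: a point set `P` together with a set of lines (subsets of `P`),
each line having at least two points, and any two distinct points lying on
exactly one line. -/
structure LinearSpace (P : Type*) where
  lines : Set (Set P)
  two_points : ∀ l ∈ lines, ∃ A B : P, A ≠ B ∧ A ∈ l ∧ B ∈ l
  unique_line : ∀ A B : P, A ≠ B → ∃! l, l ∈ lines ∧ A ∈ l ∧ B ∈ l

namespace LinearSpace

variable {P : Type*} (LS : LinearSpace P)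

/-- A subspace: a subset containing, with any two of its distinct points,
the line joining them. -/
def IsSubspace (S : Set P) : Prop :=
  ∀ l ∈ LS.lines, ∀ A ∈ l, ∀ B ∈ l, A ≠ B → A ∈ S → B ∈ S → l ⊆ S

/-- The span of a subset: the intersection of all subspaces containing it. -/
def span (S : Set P) : Set P :=
  ⋂₀ {T | LS.IsSubspace T ∧ S ⊆ T}

/-- The dimension of a subset `S` (intended for subspaces):
`min {#X - 1 | X ⊆ S, span X = S}` as an extended natural number. -/
noncomputable def sdim (S : Set P) : ℕ∞ :=
  sInf {d : ℕ∞ | ∃ X : Set P, X ⊆ S ∧ LS.span X = S ∧ d = X.encard - 1}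

/-- The dimension of the linear space: `min {#X - 1 | span X = P}`. -/
noncomputable def dim : ℕ∞ := LS.sdim Set.univ

/-- A plane is a 2-dimensional subspace. -/
def IsPlane (E : Set P) : Prop := LS.IsSubspace E ∧ LS.sdim E = 2

/-- A generalized projective space: every plane is a generalized projective
plane, i.e. any two distinct lines contained in a common plane meet. -/
def IsGenProjSpace : Prop :=
  ∀ E : Set P, LS.IsPlane E →
    ∀ l ∈ LS.lines, ∀ m ∈ LS.lines, l ⊆ E → m ⊆ E → l ≠ m → (l ∩ m).Nonempty

/-- A related set: a set of lines which pairwise meet. -/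
def IsRelatedSet (N : Set (Set P)) : Prop :=
  N ⊆ LS.lines ∧ ∀ a ∈ N, ∀ b ∈ N, (a ∩ b).Nonempty

/-- A maximal related set: a related set maximal with respect to inclusion. -/
def IsMaxRelatedSet (M : Set (Set P)) : Prop :=
  LS.IsRelatedSet M ∧ ∀ N, LS.IsRelatedSet N → M ⊆ N → N = M

/-- The star of lines with vertex `A`: all lines through `A`. -/
def star (A : P) : Set (Set P) := {l | l ∈ LS.lines ∧ A ∈ l}

/-- The pencil of planes with axis `a`: all planes containing `a`. -/
def pencil (a : Set P) : Set (Set P) := {E | LS.IsPlane E ∧ a ⊆ E}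

/-- A collineation: a bijection of the point sets mapping each line onto a
line, and whose inverse does likewise. -/
def IsCollineation {P' : Type*} (LS' : LinearSpace P') (κ : P → P') : Prop :=
  Function.Bijective κ ∧ (∀ l ∈ LS.lines, κ '' l ∈ LS'.lines) ∧
    (∀ l' ∈ LS'.lines, κ ⁻¹' l' ∈ LS.lines)

end LinearSpace

namespace LinearSpace

variable {P : Type*} {LS : LinearSpace P}

theorem eq_of_mem_of_mem {l m : Set P} (hl : l ∈ LS.lines) (hm : m ∈ LS.lines) {A B : P}
    (hAB : A ≠ B) (hAl : A ∈ l) (hBl : B ∈ l) (hAm : A ∈ m) (hBm : B ∈ m) : l = m :=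
  (LS.unique_line A B hAB).unique ⟨hl, hAl, hBl⟩ ⟨hm, hAm, hBm⟩

theorem exists_line {A B : P} (hAB : A ≠ B) : ∃ l ∈ LS.lines, A ∈ l ∧ B ∈ l :=
  (LS.unique_line A B hAB).exists

theorem exists_line_of_nontrivial [Nontrivial P] (A B : P) :
    ∃ l ∈ LS.lines, A ∈ l ∧ B ∈ l := by
  by_cases h : A = B
  · obtain ⟨C, hC⟩ := exists_ne A
    obtain ⟨l, hl, hA, -⟩ := LS.exists_line hC.symm
    exact ⟨l, hl, hA, h ▸ hA⟩
  · exact LS.exists_line h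

theorem isSubspace_of_mem_lines {l : Set P} (hl : l ∈ LS.lines) : LS.IsSubspace l := by
  intro m hm A hA B hB hAB hAl hBl
  exact (LS.eq_of_mem_of_mem hm hl hAB hA hB hAl hBl).subset

theorem isSubspace_of_subsingleton {S : Set P} (hS : S.Subsingleton) : LS.IsSubspace S :=
  fun _ _ _ _ _ _ hAB hA hB => absurd (hS hA hB) hAB

theorem subset_span (X : Set P) : X ⊆ LS.span X :=
  Set.subset_sInter fun _ hT => hT.2

theorem span_subset {X S : Set P} (hS : LS.IsSubspace S) (hX : X ⊆ S) : LS.span X ⊆ S :=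
  Set.sInter_subset_of_mem ⟨hS, hX⟩

theorem isSubspace_span (X : Set P) : LS.IsSubspace (LS.span X) :=
  fun l hl A hA B hB hAB hAX hBX => Set.subset_sInter fun T hT =>
    hT.1 l hl A hA B hB hAB (hAX T hT) (hBX T hT)

theorem span_eq_of_isSubspace {S : Set P} (hS : LS.IsSubspace S) : LS.span S = S :=
  (span_subset hS subset_rfl).antisymm (subset_span S)

theorem span_pair {l : Set P} (hl : l ∈ LS.lines) {A B : P} (hAB : A ≠ B) (hA : A ∈ l)
    (hB : B ∈ l) : LS.span {A, B} = l :=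
  (span_subset (isSubspace_of_mem_lines hl) (Set.pair_subset hA hB)).antisymm <|
    isSubspace_span _ l hl A hA B hB hAB (subset_span _ (by simp)) (subset_span _ (by simp))

theorem sdim_span_le (X : Set P) : LS.sdim (LS.span X) ≤ X.encard - 1 :=
  sInf_le ⟨X, subset_span X, rfl, rfl⟩

theorem exists_line_superset [Nontrivial P] {X : Set P} (hX : X.encard ≤ 2) :
    ∃ l ∈ LS.lines, X ⊆ l := by
  have hfin : X.Finite := Set.finite_of_encard_le_coe hX
  lift X to Finset P using hfin
  classical
  rw [Set.encard_coe_eq_coe_finsetCard] at hX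
  have hcard : X.card ≤ 2 := by exact_mod_cast hX
  have : X = ∅ ∨ (∃ A, X = {A}) ∨ ∃ A B, A ≠ B ∧ X = {A, B} := by
    interval_cases h : X.card
    · exact .inl (Finset.card_eq_zero.1 h)
    · exact .inr (.inl (Finset.card_eq_one.1 h))
    · exact .inr (.inr (Finset.card_eq_two.1 h))
  rcases this with rfl | ⟨A, rfl⟩ | ⟨A, B, -, rfl⟩
  · obtain ⟨A⟩ : Nonempty P := inferInstance
    obtain ⟨l, hl, -⟩ := LS.exists_line_of_nontrivial A A
    exact ⟨l, hl, by simp⟩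
  · obtain ⟨l, hl, hA, -⟩ := LS.exists_line_of_nontrivial A A
    exact ⟨l, hl, by simpa using hA⟩
  · obtain ⟨l, hl, hA, hB⟩ := LS.exists_line_of_nontrivial A B
    exact ⟨l, hl, by simpa using Set.pair_subset hA hB⟩

/-- Three noncollinear points span a plane. -/
theorem isPlane_span_triple [Nontrivial P] {A B C : P}
    (h : ∀ l ∈ LS.lines, A ∈ l → B ∈ l → C ∉ l) : LS.IsPlane (LS.span {A, B, C}) := by
  refine ⟨isSubspace_span _, le_antisymm ?_ ?_⟩
  · refine (sdim_span_le _).trans ?_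
    have h3 : ({A, B, C} : Set P).encard ≤ 3 := by
      classical
      have := Finset.card_le_three (a := A) (b := B) (c := C)
      rw [show ({A, B, C} : Set P) = (({A, B, C} : Finset P) : Set P) by simp,
        Set.encard_coe_eq_coe_finsetCard]
      exact_mod_cast this
    exact (tsub_le_tsub_right h3 1).trans (by decide)
  · refine le_sInf ?_
    rintro d ⟨X, -, hX, rfl⟩
    by_contra! hlt
    have hX2 : X.encard ≤ 2 := by
      by_contra! h2
      have h3 : (2 : ℕ∞) + 1 ≤ X.encard := Order.add_one_le_of_lt h2
      have := tsub_le_tsub_right h3 1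
      exact absurd (this.trans_lt hlt) (by decide)
    obtain ⟨l, hl, hXl⟩ := LS.exists_line_superset hX2
    have hsub : {A, B, C} ⊆ l :=
      (subset_span _).trans (hX ▸ span_subset (isSubspace_of_mem_lines hl) hXl)
    exact h l hl (hsub (by simp)) (hsub (by simp)) (hsub (by simp))

/-- The union of `{p}` and all lines joining `p` to a point of `S`. -/
def join (LS : LinearSpace P) (p : P) (S : Set P) : Set P :=
  {q | q = p ∨ ∃ l ∈ LS.lines, p ∈ l ∧ q ∈ l ∧ (S ∩ l).Nonempty}

theorem subset_join {p : P} {S : Set P} : S ⊆ LS.join p S := by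
  intro q hq
  by_cases h : q = p
  · exact .inl h
  · obtain ⟨l, hl, hql, hpl⟩ := LS.exists_line h
    exact .inr ⟨l, hl, hpl, hql, q, hq, hql⟩

theorem IsGenProjSpace.isSubspace_join (hG : LS.IsGenProjSpace) {S : Set P}
    (hS : LS.IsSubspace S) {p : P} (hp : p ∉ S) : LS.IsSubspace (LS.join p S) := by
  intro l hl A hA B hB hAB hAJ hBJ C hC
  by_cases hCp : C = p
  · exact .inl hCp
  rcases hAJ with rfl | ⟨a, ha, hpa, hAa, s, hs, hsa⟩ <;>
    rcases hBJ with rfl | ⟨b, hb, hpb, hBb, t, ht, htb⟩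
  · exact absurd rfl hAB
  · obtain rfl := LS.eq_of_mem_of_mem hl hb hAB hA hB hpb hBb
    exact .inr ⟨l, hl, hA, hC, t, ht, htb⟩
  · obtain rfl := LS.eq_of_mem_of_mem hl ha hAB hA hB hAa hpa
    exact .inr ⟨l, hl, hB, hC, s, hs, hsa⟩
  have hps : p ≠ s := fun h => hp (h ▸ hs)
  have hpt : p ≠ t := fun h => hp (h ▸ ht)
  by_cases hab : a = b
  · subst hab
    obtain rfl := LS.eq_of_mem_of_mem hl ha hAB hA hB hAa hBb
    exact .inr ⟨l, hl, hpa, hC, s, hs, hsa⟩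
  have hst : s ≠ t := by
    rintro rfl
    exact hab (LS.eq_of_mem_of_mem ha hb hps hpa hsa hpb htb)
  have : Nontrivial P := ⟨s, t, hst⟩
  have hplane : LS.IsPlane (LS.span {p, s, t}) := by
    refine isPlane_span_triple fun m hm hpm hsm htm => hab ?_
    exact (LS.eq_of_mem_of_mem ha hm hps hpa hsa hpm hsm).trans
      (LS.eq_of_mem_of_mem hb hm hpt hpb htb hpm htm).symm
  set F := LS.span {p, s, t} with hF
  have hpF : p ∈ F := subset_span _ (by simp)
  have hsF : s ∈ F := subset_span _ (by simp)
  have htF : t ∈ F := subset_span _ (by simp)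
  have haF : a ⊆ F := hplane.1 a ha p hpa s hsa hps hpF hsF
  have hbF : b ⊆ F := hplane.1 b hb p hpb t htb hpt hpF htF
  have hCF : C ∈ F := hplane.1 l hl A hA B hB hAB (haF hAa) (hbF hBb) hC
  obtain ⟨m, hm, hsm, htm⟩ := LS.exists_line hst
  obtain ⟨n, hn, hCn, hpn⟩ := LS.exists_line hCp
  have hmS : m ⊆ S := hS m hm s hsm t htm hst hs ht
  obtain ⟨x, hxn, hxm⟩ := hG F hplane n hn m hm (hplane.1 n hn C hCn p hpn hCp hCF hpF)
    (hplane.1 m hm s hsm t htm hst hsF htF) (fun h => hp (hmS (h ▸ hpn)))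
  exact .inr ⟨n, hn, hpn, hCn, x, hmS hxm, hxn⟩

theorem IsGenProjSpace.span_insert_subset_join (hG : LS.IsGenProjSpace) {S : Set P}
    (hS : LS.IsSubspace S) {p : P} (hp : p ∉ S) : LS.span (insert p S) ⊆ LS.join p S :=
  span_subset (hG.isSubspace_join hS hp) (Set.insert_subset (.inl rfl) subset_join)

/-- The exchange property of generalized projective spaces. -/
theorem IsGenProjSpace.exchange (hG : LS.IsGenProjSpace) {S T : Set P}
    (hS : LS.IsSubspace S) (hT : LS.IsSubspace T) (hST : S ⊆ T) {p x : P} (hpS : p ∉ S)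
    (hpT : p ∈ T) (hp : p ∈ LS.span (insert x S)) : x ∈ T := by
  by_cases hx : x ∈ S
  · exact hST hx
  rcases hG.span_insert_subset_join hS hx hp with rfl | ⟨l, hl, hxl, hpl, s, hs, hsl⟩
  · exact hpT
  · exact hT l hl p hpl s hsl (fun h => hpS (h ▸ hs)) hpT (hST hs) hxl

/-- Passing from a subspace to a properly larger one saves a generator. -/
theorem IsGenProjSpace.exists_card_lt (hG : LS.IsGenProjSpace) (X : Finset P) :
    ∀ {S T : Set P}, LS.IsSubspace S → LS.IsSubspace T → S ⊂ T →
      LS.span (S ∪ X) = Set.univ →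
      ∃ Y : Finset P, Y.card < X.card ∧ LS.span (T ∪ Y) = Set.univ := by
  classical
  induction X using Finset.induction_on with
  | empty =>
    intro S T hS hT hST hspan
    rw [Finset.coe_empty, Set.union_empty, span_eq_of_isSubspace hS] at hspan
    exact absurd (Set.subset_univ T) (hspan ▸ hST.2)
  | insert x X hx ih =>
    intro S T hS hT hST hspan
    obtain ⟨p, hpT, hpS⟩ := Set.exists_of_ssubset hST
    have hSS : S ⊆ LS.span (insert x S) := (Set.subset_insert x S).trans (subset_span _)
    by_cases hp : p ∈ LS.span (insert x S)
    · refine ⟨X, by simp [hx], Set.univ_subset_iff.1 (hspan ▸ ?_)⟩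
      have hxT := hG.exchange hS hT hST.1 hpS hpT hp
      refine span_subset (isSubspace_span _) (Set.Subset.trans ?_ (subset_span _))
      rw [Finset.coe_insert]
      exact Set.union_subset (hST.1.trans Set.subset_union_left)
        (Set.insert_subset (.inl hxT) Set.subset_union_right)
    · have hss : LS.span (insert x S) ⊂ LS.span (insert x T) := by
        refine (Set.ssubset_iff_of_subset ?_).2
          ⟨p, subset_span _ (.inr hpT), hp⟩
        exact span_subset (isSubspace_span _)
          ((Set.insert_subset_insert hST.1).trans (subset_span _))
      obtain ⟨Y, hY, hYspan⟩ := ih (isSubspace_span _) (isSubspace_span _) hss <| by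
        refine Set.univ_subset_iff.1 (hspan ▸ ?_)
        refine span_subset (isSubspace_span _) (Set.Subset.trans ?_ (subset_span _))
        rw [Finset.coe_insert]
        exact Set.union_subset (hSS.trans Set.subset_union_left)
          (Set.insert_subset (.inl (subset_span _ (.inl rfl))) Set.subset_union_right)
      refine ⟨insert x Y, ?_, Set.univ_subset_iff.1 (hYspan ▸ ?_)⟩
      · rw [Finset.card_insert_of_notMem hx]
        exact (Finset.card_insert_le x Y).trans_lt (by omega)
      · refine span_subset (isSubspace_span _) (Set.union_subset ?_ ?_)
        · refine span_subset (isSubspace_span _) (Set.Subset.trans ?_ (subset_span _))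
          rw [Finset.coe_insert]
          exact Set.insert_subset (.inr (.inl rfl)) Set.subset_union_left
        · refine Set.Subset.trans ?_ (subset_span _)
          rw [Finset.coe_insert]
          exact (Set.subset_insert x _).trans Set.subset_union_right

/-- A plane properly contains a line, i.e. the span of two distinct points. -/
theorem IsPlane.exists_line_ssubset {E : Set P} (hE : LS.IsPlane E) :
    ∃ l ∈ LS.lines, l ⊂ E := by
  have key : ∀ X : Set P, X.encard ≤ 2 → LS.span X ≠ E := by
    rintro X hX rfl
    have h := (sdim_span_le (LS := LS) X).trans (tsub_le_tsub_right hX 1)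
    rw [hE.2] at h
    exact absurd h (by decide)
  have hnt : E.Nontrivial := by
    by_contra h
    rw [Set.not_nontrivial_iff] at h
    exact key E ((Set.encard_le_one_iff_subsingleton.2 h).trans (by decide))
      (span_eq_of_isSubspace hE.1)
  obtain ⟨A, hA, B, hB, hAB⟩ := hnt
  obtain ⟨l, hl, hAl, hBl⟩ := LS.exists_line hAB
  refine ⟨l, hl, (hE.1 l hl A hAl B hBl hAB hA hB).ssubset_of_ne ?_⟩
  rw [← LS.span_pair hl hAB hAl hBl]
  exact key _ (Set.encard_pair hAB).le

theorem exists_finset_span_eq_univ (hdim : LS.dim = 3) :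
    ∃ X : Finset P, X.card = 4 ∧ LS.span X = Set.univ := by
  have hne : {d : ℕ∞ | ∃ X : Set P, X ⊆ Set.univ ∧ LS.span X = Set.univ ∧
      d = X.encard - 1}.Nonempty :=
    ⟨_, Set.univ, subset_rfl, Set.univ_subset_iff.1 (subset_span _), rfl⟩
  obtain ⟨X, -, hX, hd⟩ := csInf_mem hne
  have h3 : (3 : ℕ∞) = X.encard - 1 := hdim.symm.trans hd
  have hfin : X.Finite := by
    rw [← Set.encard_ne_top_iff]
    intro h
    rw [h] at h3
    exact absurd h3 (by decide)
  lift X to Finset P using hfin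
  rw [Set.encard_coe_eq_coe_finsetCard] at h3
  have h3' : 3 = X.card - 1 := by exact_mod_cast h3
  exact ⟨X, by omega, hX⟩

/-- In a 3-dimensional generalized projective space, a plane is a maximal proper subspace. -/
theorem IsGenProjSpace.eq_univ_of_plane_ssubset (hG : LS.IsGenProjSpace) (hdim : LS.dim = 3)
    {E T : Set P} (hE : LS.IsPlane E) (hT : LS.IsSubspace T) (hET : E ⊂ T) :
    T = Set.univ := by
  obtain ⟨l, hl, hlE⟩ := hE.exists_line_ssubset
  obtain ⟨A, B, hAB, hA, hB⟩ := LS.two_points l hl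
  have hAl : {A} ⊂ l :=
    (Set.ssubset_iff_of_subset (by simpa using hA)).2 ⟨B, hB, by simpa using hAB.symm⟩
  have hempty : LS.IsSubspace ∅ := isSubspace_of_subsingleton Set.subsingleton_empty
  have hpoint : LS.IsSubspace {A} := isSubspace_of_subsingleton Set.subsingleton_singleton
  have hline := isSubspace_of_mem_lines hl
  obtain ⟨X, hX, hXspan⟩ := exists_finset_span_eq_univ hdim
  obtain ⟨X₁, h₁, hX₁⟩ := hG.exists_card_lt X hempty hpoint
    (Set.empty_ssubset.2 (Set.singleton_nonempty A)) (by rwa [Set.empty_union])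
  obtain ⟨X₂, h₂, hX₂⟩ := hG.exists_card_lt X₁ hpoint hline hAl hX₁
  obtain ⟨X₃, h₃, hX₃⟩ := hG.exists_card_lt X₂ hline hE.1 hlE hX₂
  obtain ⟨X₄, h₄, hX₄⟩ := hG.exists_card_lt X₃ hE.1 hT hET hX₃
  obtain rfl : X₄ = ∅ := Finset.card_eq_zero.1 (by omega)
  rwa [Finset.coe_empty, Set.union_empty, span_eq_of_isSubspace hT] at hX₄

end LinearSpace

/-- In a 3-dimensional generalized projective space every plane and every
line have a common point. -/
theorem plane_meets_line
    {P : Type*} (LS : LinearSpace P) (hdim : LS.dim = 3)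
    (hGPS : LS.IsGenProjSpace)
    (E : Set P) (hE : LS.IsPlane E) (y : Set P) (hy : y ∈ LS.lines) :
    (E ∩ y).Nonempty := by
  obtain ⟨p, q, hpq, hp, hq⟩ := LS.two_points y hy
  by_cases hpE : p ∈ E
  · exact ⟨p, hpE, hp⟩
  have hss : E ⊂ LS.join p E :=
    (Set.ssubset_iff_of_subset LinearSpace.subset_join).2 ⟨p, .inl rfl, hpE⟩
  have hq' : q ∈ LS.join p E := by
    rw [hGPS.eq_univ_of_plane_ssubset hdim hE (hGPS.isSubspace_join hE.1 hpE) hss]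
    trivial
  rcases hq' with h | ⟨l, hl, hpl, hql, hne⟩
  · exact absurd h.symm hpq
  · rwa [LS.eq_of_mem_of_mem hy hl hpq hp hq hpl hql]
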